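/- Let u ∈ H²_{0,mesh}(𝒯) := H²(𝒯) ∩ H¹₀(Ω) (piecewise H², globally H¹₀). There exists an operator F⁰ mapping u to q ∈ P⁴_b(𝒯) (piecewise quartic element bubbles, hence q ∈ H¹₀(Ω)) such that: (i) ⟨δη, F⁰u⟩_𝒮 = ⟨δη, u⟩_𝒮 for all δη ∈ P⁰(𝒮), i.e., the edgewise mean values of the normal-derivative jumps agree; and (ii) ‖F⁰u‖ + ‖h_𝒯² D²F⁰u‖_𝒯 ≲ ‖u‖ + ‖h_𝒯² D²u‖_𝒯 with hidden constant depending only on shape regularity. -/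

import Mathlib

open MeasureTheory
open scoped RealInnerProductSpace

noncomputable section

/-- The Euclidean plane. -/
abbrev E2 := EuclideanSpace ℝ (Fin 2)

/-- The (closed) triangle of the mesh element `i`. -/
def elt (V : ℕ → Fin 3 → E2) (i : ℕ) : Set E2 :=
  convexHull ℝ (Set.range (V i))

/-- The skeleton pairing `Σ_T Σ_{E ⊆ ∂T} ∫_E η ∂_n v` of an edgewise-constant
function `η` (a symmetric function of the two edge endpoints) against the
normal derivatives of the element-wise functions `f i`; `nrm i k` is the outer
unit normal of the edge of element `i` opposite its vertex `V i k`, which is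
parametrized by `t ↦ V i (k+1) + t•(V i (k+2) − V i (k+1))`.
Up to its (irrelevant) global sign this is the pairing `⟨η, v⟩_𝒮` of (3.22). -/
def skelPair (s : Finset ℕ) (V : ℕ → Fin 3 → E2) (nrm : ℕ → Fin 3 → E2)
    (η : E2 → E2 → ℝ) (f : ℕ → E2 → ℝ) : ℝ :=
  ∑ i ∈ s, ∑ k : Fin 3,
    η (V i (k+1)) (V i (k+2)) * ‖V i (k+2) - V i (k+1)‖ *
      ∫ t in (0:ℝ)..1,
        fderiv ℝ (f i) (V i (k+1) + t • (V i (k+2) - V i (k+1))) (nrm i k)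

/-- The determinant of two plane vectors. -/
def planeCross (X Y : E2) : ℝ := X 0 * Y 1 - X 1 * Y 0

theorem integral_euclidean_unitSquare (F : E2 → ℝ) (hF : Continuous F) :
    ∫ x in {x : E2 | ∀ i, x i ∈ Set.Ioo (0 : ℝ) 1}, F x
      = ∫ s in (0 : ℝ)..1, ∫ r in (0 : ℝ)..1, F !₂[s, r] := by
  have hmp : MeasurePreserving ((MeasurableEquiv.finTwoArrow (α := ℝ)).symm.trans
      (MeasurableEquiv.toLp 2 (Fin 2 → ℝ))) :=
    (PiLp.volume_preserving_toLp (Fin 2)).comp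
      (volume_preserving_finTwoArrow ℝ).symm
  have hpre := hmp.setIntegral_preimage_emb (MeasurableEquiv.measurableEmbedding _) F
    {x : E2 | ∀ i, x i ∈ Set.Ioo (0 : ℝ) 1}
  have hset : ((MeasurableEquiv.finTwoArrow (α := ℝ)).symm.trans
      (MeasurableEquiv.toLp 2 (Fin 2 → ℝ))) ⁻¹' {x : E2 | ∀ i, x i ∈ Set.Ioo (0 : ℝ) 1}
      = Set.Ioo (0 : ℝ) 1 ×ˢ Set.Ioo (0 : ℝ) 1 := by
    ext ⟨a, b⟩
    simp [Fin.forall_fin_two, MeasurableEquiv.finTwoArrow]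
  have hval : ∀ x : ℝ × ℝ, ((MeasurableEquiv.finTwoArrow (α := ℝ)).symm.trans
      (MeasurableEquiv.toLp 2 (Fin 2 → ℝ))) x = !₂[x.1, x.2] := by
    rintro ⟨a, b⟩
    ext i
    fin_cases i <;> simp [MeasurableEquiv.finTwoArrow]
  have hc : Continuous fun x : ℝ × ℝ => F !₂[x.1, x.2] := by
    refine hF.comp ?_
    refine (PiLp.continuous_toLp 2 _).comp ?_
    refine continuous_pi fun i => ?_
    fin_cases i <;> simp <;> fun_prop
  rw [← hpre, hset]
  simp only [hval]
  rw [Measure.volume_eq_prod, setIntegral_prod]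
  · simp only [intervalIntegral.integral_of_le zero_le_one, integral_Ioc_eq_integral_Ioo]
  · rw [← Measure.volume_eq_prod]
    exact (hc.continuousOn.integrableOn_compact (isCompact_Icc.prod isCompact_Icc)).mono_set
      (Set.prod_mono Set.Ioo_subset_Icc_self Set.Ioo_subset_Icc_self)

/-- Integration over a triangle in collapsed coordinates centred at its vertex `P`. -/
theorem cross_mul_integral_collapsed_le {P X Y : E2} {T : Set E2} (hT : IsCompact T)
    (hD : planeCross X Y ≠ 0)
    (hmem : ∀ s ∈ Set.Icc (0 : ℝ) 1, ∀ r ∈ Set.Icc (0 : ℝ) 1, P + r • (X + s • Y) ∈ T)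
    {H : E2 → ℝ} (hH : Continuous H) (h0 : ∀ p, 0 ≤ H p) :
    |planeCross X Y| * ∫ s in (0 : ℝ)..1, ∫ r in (0 : ℝ)..1, r * H (P + r • (X + s • Y))
      ≤ ∫ p in T, H p := by
  set S : Set E2 := {x : E2 | ∀ i, x i ∈ Set.Ioo (0 : ℝ) 1} with hS
  set Ψ : E2 → E2 := fun x => P + x 1 • (X + x 0 • Y) with hΨ
  let p0 : E2 →L[ℝ] ℝ := EuclideanSpace.proj 0
  let p1 : E2 →L[ℝ] ℝ := EuclideanSpace.proj 1
  let Ψ' : E2 → E2 →L[ℝ] E2 := fun x =>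
    x 1 • p0.smulRight Y + p1.smulRight (X + x 0 • Y)
  have hd : ∀ x, HasFDerivAt Ψ (Ψ' x) x := by
    intro x
    have h0 : HasFDerivAt (fun x : E2 => x 0) p0 x := p0.hasFDerivAt
    have h1 : HasFDerivAt (fun x : E2 => x 1) p1 x := p1.hasFDerivAt
    exact (h1.smul ((h0.smul_const Y).const_add X)).const_add P
  have hdet : ∀ x, (Ψ' x).det = - (x 1 * planeCross X Y) := by
    intro x
    rw [ContinuousLinearMap.det, ← LinearMap.det_toMatrix (EuclideanSpace.basisFun (Fin 2) ℝ).toBasis,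
      Matrix.det_fin_two]
    simp [LinearMap.toMatrix_apply, Ψ', p0, p1, planeCross]
    ring
  have hSm : MeasurableSet S := by
    have : S = ⋂ i, (fun x : E2 => x i) ⁻¹' Set.Ioo (0 : ℝ) 1 := by
      ext x; simp [hS]
    rw [this]
    refine MeasurableSet.iInter fun i => ?_
    exact ((by fun_prop : Continuous fun x : E2 => x i).measurable) measurableSet_Ioo
  have hinj : Set.InjOn Ψ S := by
    intro x hx y hy hxy
    have hxy' : x 1 • (X + x 0 • Y) = y 1 • (X + y 0 • Y) := add_left_cancel hxy
    have e0 := congrArg (fun v : E2 => v 0) hxy'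
    have e1 := congrArg (fun v : E2 => v 1) hxy'
    simp only [PiLp.smul_apply, PiLp.add_apply, smul_eq_mul] at e0 e1
    have k1 : x 1 = y 1 := by
      refine mul_right_cancel₀ hD ?_
      unfold planeCross
      linear_combination Y 1 * e0 - Y 0 * e1
    have hy1 : y 1 ≠ 0 := (hy 1).1.ne'
    have k0 : x 0 = y 0 := by
      refine mul_right_cancel₀ hD (mul_left_cancel₀ hy1 ?_)
      rw [k1] at e0 e1
      unfold planeCross
      linear_combination X 0 * e1 - X 1 * e0
    ext i
    fin_cases i
    · exact k0
    · exact k1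
  have hcov := integral_image_eq_integral_abs_det_fderiv_smul volume hSm
    (fun x _ => (hd x).hasFDerivWithinAt) hinj H
  have hsub : Ψ '' S ⊆ T := by
    rintro _ ⟨x, hx, rfl⟩
    exact hmem _ (Set.Ioo_subset_Icc_self (hx 0)) _ (Set.Ioo_subset_Icc_self (hx 1))
  have hle : ∫ p in Ψ '' S, H p ≤ ∫ p in T, H p :=
    setIntegral_mono_set (hH.continuousOn.integrableOn_compact hT)
      (Filter.Eventually.of_forall h0) hsub.eventuallyLE
  refine le_trans (le_of_eq ?_) hle
  rw [hcov]
  have hrhs : ∫ x in S, |(Ψ' x).det| • H (Ψ x)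
      = ∫ x in S, |planeCross X Y| * (x 1 * H (Ψ x)) := by
    refine setIntegral_congr_fun hSm fun x hx => ?_
    simp only [hdet, abs_neg, abs_mul, abs_of_pos (hx 1).1, smul_eq_mul]
    ring
  rw [hrhs, integral_const_mul, hS, integral_euclidean_unitSquare]
  · simp [hΨ]
  · simp only [hΨ]; fun_prop

theorem sq_intervalIntegral_le {f : ℝ → ℝ} (hf : Continuous f) :
    (∫ x in (0 : ℝ)..1, f x) ^ 2 ≤ ∫ x in (0 : ℝ)..1, f x ^ 2 := by
  set m := ∫ x in (0 : ℝ)..1, f x with hm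
  have h0 : 0 ≤ ∫ x in (0 : ℝ)..1, (f x - m) ^ 2 :=
    intervalIntegral.integral_nonneg zero_le_one fun x _ => sq_nonneg _
  have h1 : ∫ x in (0 : ℝ)..1, (f x - m) ^ 2
      = (∫ x in (0 : ℝ)..1, f x ^ 2) - 2 * m * m + m ^ 2 := by
    have : (fun x => (f x - m) ^ 2) = fun x => f x ^ 2 - 2 * m * f x + m ^ 2 := by
      ext x; ring
    rw [this, intervalIntegral.integral_add, intervalIntegral.integral_sub,
      intervalIntegral.integral_const_mul, ← hm]
    · simp
    all_goals exact Continuous.intervalIntegrable (by fun_prop) _ _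
  nlinarith

theorem sq_iteratedIntegral_le {F : ℝ → ℝ → ℝ} (hF : Continuous (Function.uncurry F)) :
    (∫ s in (0 : ℝ)..1, ∫ r in (0 : ℝ)..1, F s r) ^ 2
      ≤ ∫ s in (0 : ℝ)..1, ∫ r in (0 : ℝ)..1, F s r ^ 2 := by
  have h1 : Continuous fun s => ∫ r in (0 : ℝ)..1, F s r :=
    intervalIntegral.continuous_parametric_intervalIntegral_of_continuous' hF 0 1
  have hF2 : Continuous (Function.uncurry fun s r => F s r ^ 2) := hF.pow 2
  have h2 : Continuous fun s => ∫ r in (0 : ℝ)..1, F s r ^ 2 :=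
    intervalIntegral.continuous_parametric_intervalIntegral_of_continuous' hF2 0 1
  refine (sq_intervalIntegral_le h1).trans ?_
  refine intervalIntegral.integral_mono_on zero_le_one
    ((h1.pow 2).intervalIntegrable _ _) (h2.intervalIntegrable _ _) fun s _ => ?_
  exact sq_intervalIntegral_le (hF.comp (by fun_prop : Continuous fun r => (s, r)))

theorem volume_triangle_le (P X Y : E2) :
    (volume (convexHull ℝ {P, P + X, P + X + Y})).toReal ≤ |planeCross X Y| := by
  have hsub : convexHull ℝ {P, P + X, P + X + Y} ⊆
      (fun v => P + v) '' parallelepiped ![X, Y] := by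
    refine convexHull_min ?_ ?_
    · intro p hp
      simp only [parallelepiped_eq_sum_segment, Set.mem_image]
      simp only [Fin.sum_univ_two, Matrix.cons_val_zero, Matrix.cons_val_one]
      rcases hp with rfl | rfl | rfl
      · exact ⟨0, ⟨0, left_mem_segment _ _ _, 0, left_mem_segment _ _ _, by simp⟩, by simp⟩
      · exact ⟨X, ⟨X, right_mem_segment _ _ _, 0, left_mem_segment _ _ _, by simp⟩, rfl⟩
      · exact ⟨X + Y, ⟨X, right_mem_segment _ _ _, Y, right_mem_segment _ _ _, rfl⟩,
          by simp [add_assoc]⟩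
    · have := (convex_parallelepiped ![X, Y]).translate P
      exact this
  have hvol : volume (parallelepiped ![X, Y]) = ENNReal.ofReal |planeCross X Y| := by
    rw [← (EuclideanSpace.basisFun (Fin 2) ℝ).addHaar_eq_volume, Measure.addHaar_parallelepiped]
    congr 2
    rw [Module.Basis.det_apply, Matrix.det_fin_two]
    simp [Module.Basis.toMatrix_apply, planeCross]
    ring
  have h1 := measure_mono (μ := volume) hsub
  have h2 : volume ((fun v => P + v) '' parallelepiped ![X, Y])
      = volume (parallelepiped ![X, Y]) := by
    rw [Set.image_add_left, measure_preimage_add]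
  rw [h2, hvol] at h1
  exact ENNReal.toReal_le_of_le_ofReal (abs_nonneg _) h1

theorem abs_hessian_apply_le (u : E2 → ℝ) (p e : E2) :
    |fderiv ℝ (fderiv ℝ u) p e e| ≤ ‖iteratedFDeriv ℝ 2 u p‖ * ‖e‖ ^ 2 := by
  have h := (iteratedFDeriv ℝ 2 u p).le_opNorm ![e, e]
  rw [iteratedFDeriv_two_apply] at h
  simpa [pow_two, Fin.prod_univ_two] using h

theorem continuous_hessian_apply {u : E2 → ℝ} (hu : ContDiff ℝ 2 u) {a : Type*}
    [TopologicalSpace a] {p e : a → E2} (hp : Continuous p) (he : Continuous e) :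
    Continuous fun x => fderiv ℝ (fderiv ℝ u) (p x) (e x) (e x) := by
  have h1 : ContDiff ℝ 1 (fderiv ℝ u) := hu.fderiv_right (by norm_num)
  have h2 : Continuous (fderiv ℝ (fderiv ℝ u)) := h1.continuous_fderiv (by norm_num)
  exact ((h2.comp hp).clm_apply he).clm_apply he

/-- The weighted second-order energy controlling traces on a triangle of size `h`. -/
def hessEnergy (T : Set E2) (h : ℝ) (u : E2 → ℝ) : ℝ :=
  (∫ p in T, u p ^ 2) + h ^ 4 * ∫ p in T, ‖iteratedFDeriv ℝ 2 u p‖ ^ 2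

theorem hessEnergy_nonneg (T : Set E2) (h : ℝ) (u : E2 → ℝ) : 0 ≤ hessEnergy T h u := by
  unfold hessEnergy
  have h1 : 0 ≤ ∫ p in T, u p ^ 2 := integral_nonneg fun _ => sq_nonneg _
  have h2 : 0 ≤ ∫ p in T, ‖iteratedFDeriv ℝ 2 u p‖ ^ 2 := integral_nonneg fun _ => sq_nonneg _
  positivity

theorem sq_weighted_integral_le {P X Y : E2} {T : Set E2} (hT : IsCompact T)
    (hD : planeCross X Y ≠ 0)
    (hmem : ∀ s ∈ Set.Icc (0 : ℝ) 1, ∀ r ∈ Set.Icc (0 : ℝ) 1, P + r • (X + s • Y) ∈ T)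
    {h : ℝ} (hh : ∀ s ∈ Set.Icc (0 : ℝ) 1, ‖X + s • Y‖ ≤ h)
    {u : E2 → ℝ} (hu : ContDiff ℝ 2 u) {a b : ℝ → ℝ} (ha : Continuous a) (hb : Continuous b)
    (ha5 : ∀ r ∈ Set.Icc (0 : ℝ) 1, |a r| ≤ 5) (hb30 : ∀ r ∈ Set.Icc (0 : ℝ) 1, |b r| ≤ 30) :
    |planeCross X Y| * (∫ s in (0 : ℝ)..1, ∫ r in (0 : ℝ)..1,
      r * (a r * fderiv ℝ (fderiv ℝ u) (P + r • (X + s • Y)) (X + s • Y) (X + s • Y)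
        - b r * u (P + r • (X + s • Y)))) ^ 2 ≤ 1800 * hessEnergy T h u := by
  have hcu : Continuous u := hu.continuous
  have hcd : Continuous (iteratedFDeriv ℝ 2 u) := hu.continuous_iteratedFDeriv le_rfl
  set H : E2 → ℝ := fun p => 1800 * (u p ^ 2 + h ^ 4 * ‖iteratedFDeriv ℝ 2 u p‖ ^ 2) with hH
  have hHc : Continuous H := by simp only [hH]; fun_prop
  have hH0 : ∀ p, 0 ≤ H p := fun p => by simp only [hH]; positivity
  have hint : ∫ p in T, H p = 1800 * hessEnergy T h u := by
    have i1 : IntegrableOn (fun p => u p ^ 2) T :=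
      (by fun_prop : Continuous fun p => u p ^ 2).continuousOn.integrableOn_compact hT
    have i2 : IntegrableOn (fun p => h ^ 4 * ‖iteratedFDeriv ℝ 2 u p‖ ^ 2) T :=
      (by fun_prop : Continuous fun p => h ^ 4 * ‖iteratedFDeriv ℝ 2 u p‖ ^ 2
        ).continuousOn.integrableOn_compact hT
    simp only [hH]
    rw [integral_const_mul, integral_add i1 i2, integral_const_mul, hessEnergy]
  have hmain := cross_mul_integral_collapsed_le hT hD hmem hHc hH0
  rw [hint] at hmain
  refine le_trans (mul_le_mul_of_nonneg_left ?_ (abs_nonneg _)) hmain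
  have hhess : Continuous fun x : ℝ × ℝ =>
      fderiv ℝ (fderiv ℝ u) (P + x.2 • (X + x.1 • Y)) (X + x.1 • Y) (X + x.1 • Y) :=
    continuous_hessian_apply hu (by fun_prop) (by fun_prop)
  have hFc : Continuous (Function.uncurry fun s r : ℝ =>
      r * (a r * fderiv ℝ (fderiv ℝ u) (P + r • (X + s • Y)) (X + s • Y) (X + s • Y)
        - b r * u (P + r • (X + s • Y)))) := by
    simp only [Function.uncurry_def]
    fun_prop
  have hGc : Continuous (Function.uncurry fun s r : ℝ => r * H (P + r • (X + s • Y))) := by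
    simp only [Function.uncurry_def]
    fun_prop
  have hFc2 : Continuous (Function.uncurry fun s r : ℝ =>
      (r * (a r * fderiv ℝ (fderiv ℝ u) (P + r • (X + s • Y)) (X + s • Y) (X + s • Y)
        - b r * u (P + r • (X + s • Y)))) ^ 2) := hFc.pow 2
  refine (sq_iteratedIntegral_le hFc).trans ?_
  refine intervalIntegral.integral_mono_on zero_le_one
    ((intervalIntegral.continuous_parametric_intervalIntegral_of_continuous'
      hFc2 0 1).intervalIntegrable _ _)
    ((intervalIntegral.continuous_parametric_intervalIntegral_of_continuous'
      hGc 0 1).intervalIntegrable _ _) fun s hs => ?_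
  have hsr : Continuous fun r : ℝ => (s, r) := by fun_prop
  refine intervalIntegral.integral_mono_on zero_le_one
    ((hFc2.comp hsr).intervalIntegrable _ _) ((hGc.comp hsr).intervalIntegrable _ _) fun r hr => ?_
  set p := P + r • (X + s • Y)
  set d := fderiv ℝ (fderiv ℝ u) p (X + s • Y) (X + s • Y)
  have hd : |d| ≤ h ^ 2 * ‖iteratedFDeriv ℝ 2 u p‖ := by
    refine (abs_hessian_apply_le u p _).trans ?_
    rw [mul_comm]
    have := hh s hs
    gcongr
  have hd2 : d ^ 2 ≤ h ^ 4 * ‖iteratedFDeriv ℝ 2 u p‖ ^ 2 := by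
    have := pow_le_pow_left₀ (abs_nonneg d) hd 2
    rw [sq_abs] at this
    nlinarith
  have hA : (a r) ^ 2 ≤ 25 := by
    have := pow_le_pow_left₀ (abs_nonneg _) (ha5 r hr) 2
    rw [sq_abs] at this; linarith
  have hB : (b r) ^ 2 ≤ 900 := by
    have := pow_le_pow_left₀ (abs_nonneg _) (hb30 r hr) 2
    rw [sq_abs] at this; linarith
  have hr2 : r ^ 2 ≤ r := by nlinarith [hr.1, hr.2]
  have e1 : (a r * d - b r * u p) ^ 2 ≤ 2 * (a r) ^ 2 * d ^ 2 + 2 * (b r) ^ 2 * u p ^ 2 := by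
    nlinarith [sq_nonneg (a r * d + b r * u p)]
  have e2 : (a r) ^ 2 * d ^ 2 ≤ 25 * d ^ 2 := mul_le_mul_of_nonneg_right hA (sq_nonneg _)
  have e3 : (b r) ^ 2 * u p ^ 2 ≤ 900 * u p ^ 2 := mul_le_mul_of_nonneg_right hB (sq_nonneg _)
  have e4 : (a r * d - b r * u p) ^ 2 ≤ H p := by
    simp only [hH]
    nlinarith [sq_nonneg d]
  rw [mul_pow]
  exact mul_le_mul hr2 e4 (sq_nonneg _) hr.1

theorem hasDerivAt_along_ray {u : E2 → ℝ} (hu : ContDiff ℝ 2 u) (P e : E2) (r : ℝ) :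
    HasDerivAt (fun r : ℝ => u (P + r • e)) (fderiv ℝ u (P + r • e) e) r := by
  have h1 : HasDerivAt (fun r : ℝ => P + r • e) e r := by
    simpa using ((hasDerivAt_id r).smul_const e).const_add P
  exact ((hu.differentiable (by norm_num)) _).hasFDerivAt.comp_hasDerivAt r h1

theorem hasDerivAt_fderiv_along_ray {u : E2 → ℝ} (hu : ContDiff ℝ 2 u) (P e : E2) (r : ℝ) :
    HasDerivAt (fun r : ℝ => fderiv ℝ u (P + r • e) e)
      (fderiv ℝ (fderiv ℝ u) (P + r • e) e e) r := by
  have h1 : HasDerivAt (fun r : ℝ => P + r • e) e r := by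
    simpa using ((hasDerivAt_id r).smul_const e).const_add P
  have hd : ContDiff ℝ 1 (fderiv ℝ u) := hu.fderiv_right (by norm_num)
  have h2 := ((hd.differentiable (by norm_num)) (P + r • e)).hasFDerivAt.comp_hasDerivAt r h1
  simpa using h2.clm_apply (hasDerivAt_const r e)

/-- Green's formula along a ray, against a weight `φ` with `φ' = φ₁` and `φ₁' = φ₂`. -/
theorem integral_ray_green {u : E2 → ℝ} (hu : ContDiff ℝ 2 u) (P e : E2) {φ φ₁ φ₂ : ℝ → ℝ}
    (h : ∀ r, HasDerivAt φ (φ₁ r) r) (h₁ : ∀ r, HasDerivAt φ₁ (φ₂ r) r) (hc : Continuous φ₂) :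
    ∫ r in (0 : ℝ)..1, (φ r * fderiv ℝ (fderiv ℝ u) (P + r • e) e e - φ₂ r * u (P + r • e))
      = (φ 1 * fderiv ℝ u (P + e) e - φ₁ 1 * u (P + e))
        - (φ 0 * fderiv ℝ u P e - φ₁ 0 * u P) := by
  have hφ : Continuous φ := continuous_iff_continuousAt.2 fun r => (h r).continuousAt
  have hcu : Continuous u := hu.continuous
  have hhess : Continuous fun r : ℝ => fderiv ℝ (fderiv ℝ u) (P + r • e) e e :=
    continuous_hessian_apply hu (by fun_prop) (by fun_prop)
  rw [intervalIntegral.integral_eq_sub_of_hasDerivAt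
    (f := fun r => φ r * fderiv ℝ u (P + r • e) e - φ₁ r * u (P + r • e))]
  · simp
  · intro r _
    have := ((h r).mul (hasDerivAt_fderiv_along_ray hu P e r)).sub
      ((h₁ r).mul (hasDerivAt_along_ray hu P e r))
    refine this.congr_deriv ?_
    ring
  · exact Continuous.intervalIntegrable (by fun_prop) _ _

theorem value_eq_ray_integral {u : E2 → ℝ} (hu : ContDiff ℝ 2 u) (P e : E2) :
    ∫ r in (0 : ℝ)..1, r * ((1 - 3 * r ^ 2 + 2 * r ^ 3) *
      fderiv ℝ (fderiv ℝ u) (P + r • e) e e - (24 * r - 18) * u (P + r • e)) = u P := by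
  have := integral_ray_green hu P e (φ := fun r => r - 3 * r ^ 3 + 2 * r ^ 4)
    (φ₁ := fun r => 1 - 9 * r ^ 2 + 8 * r ^ 3) (φ₂ := fun r => -18 * r + 24 * r ^ 2)
    (fun r => by
      refine (((hasDerivAt_id r).sub ((hasDerivAt_pow 3 r).const_mul 3)).add
        ((hasDerivAt_pow 4 r).const_mul 2)).congr_deriv ?_
      norm_num; ring)
    (fun r => by
      refine (((hasDerivAt_const r (1 : ℝ)).sub ((hasDerivAt_pow 2 r).const_mul 9)).add
        ((hasDerivAt_pow 3 r).const_mul 8)).congr_deriv ?_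
      norm_num; ring)
    (by fun_prop)
  norm_num at this
  rw [← this]
  congr 1
  ext r
  ring

theorem edge_trace_eq_ray_integral {u : E2 → ℝ} (hu : ContDiff ℝ 2 u) (P e : E2) :
    ∫ r in (0 : ℝ)..1, r * ((5 * r ^ 2 - 4 * r ^ 3) *
      fderiv ℝ (fderiv ℝ u) (P + r • e) e e - (30 - 48 * r) * u (P + r • e))
      = u (P + e) + fderiv ℝ u (P + e) e := by
  have := integral_ray_green hu P e (φ := fun r => 5 * r ^ 3 - 4 * r ^ 4)
    (φ₁ := fun r => 15 * r ^ 2 - 16 * r ^ 3) (φ₂ := fun r => 30 * r - 48 * r ^ 2)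
    (fun r => by
      refine (((hasDerivAt_pow 3 r).const_mul 5).sub
        ((hasDerivAt_pow 4 r).const_mul 4)).congr_deriv ?_
      norm_num; ring)
    (fun r => by
      refine (((hasDerivAt_pow 2 r).const_mul 15).sub
        ((hasDerivAt_pow 3 r).const_mul 16)).congr_deriv ?_
      norm_num; ring)
    (by fun_prop)
  norm_num at this
  rw [add_comm, ← this]
  congr 1
  ext r
  ring

/-- The oriented double area of a triangle, computed from the vertex `V k`. -/
def triangleCross (V : Fin 3 → E2) (k : Fin 3) : ℝ :=
  planeCross (V (k + 1) - V k) (V (k + 2) - V (k + 1))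

theorem triangleCross_eq_zero_index (V : Fin 3 → E2) (k : Fin 3) :
    triangleCross V k = triangleCross V 0 := by
  fin_cases k <;> simp [triangleCross, planeCross] <;> ring

theorem ray_mem_triangle (V : Fin 3 → E2) (k : Fin 3) {s r : ℝ} (hs : s ∈ Set.Icc (0 : ℝ) 1)
    (hr : r ∈ Set.Icc (0 : ℝ) 1) :
    V k + r • ((V (k + 1) - V k) + s • (V (k + 2) - V (k + 1)))
      ∈ convexHull ℝ (Set.range V) := by
  have hc := convex_convexHull ℝ (Set.range V)
  have hv : ∀ j, V j ∈ convexHull ℝ (Set.range V) := fun j => subset_convexHull ℝ _ ⟨j, rfl⟩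
  have h1 : V (k + 1) + s • (V (k + 2) - V (k + 1)) ∈ convexHull ℝ (Set.range V) :=
    hc.add_smul_sub_mem (hv _) (hv _) hs
  have h2 := hc.add_smul_sub_mem (hv k) h1 hr
  convert h2 using 3
  abel

theorem isCompact_triangle (V : Fin 3 → E2) : IsCompact (convexHull ℝ (Set.range V)) :=
  (Set.finite_range V).isCompact_convexHull ℝ

theorem norm_ray_le_diam (V : Fin 3 → E2) (k : Fin 3) {s : ℝ} (hs : s ∈ Set.Icc (0 : ℝ) 1) :
    ‖(V (k + 1) - V k) + s • (V (k + 2) - V (k + 1))‖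
      ≤ Metric.diam (convexHull ℝ (Set.range V)) := by
  have h1 := ray_mem_triangle V k hs (Set.right_mem_Icc.2 (zero_le_one' ℝ))
  have h2 : V k ∈ convexHull ℝ (Set.range V) := subset_convexHull ℝ _ ⟨k, rfl⟩
  have := Metric.dist_le_diam_of_mem (isCompact_triangle V).isBounded h1 h2
  simpa [dist_eq_norm] using this

theorem sq_vertex_value_le {V : Fin 3 → E2} (hV : triangleCross V 0 ≠ 0)
    {u : E2 → ℝ} (hu : ContDiff ℝ 2 u) (k : Fin 3) :
    |triangleCross V 0| * u (V k) ^ 2 ≤ 1800 * hessEnergy (convexHull ℝ (Set.range V))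
      (Metric.diam (convexHull ℝ (Set.range V))) u := by
  rw [← triangleCross_eq_zero_index V k] at hV ⊢
  have := sq_weighted_integral_le (isCompact_triangle V) hV
    (fun s hs r hr => ray_mem_triangle V k hs hr) (fun s hs => norm_ray_le_diam V k hs) hu
    (a := fun r => 1 - 3 * r ^ 2 + 2 * r ^ 3) (b := fun r => 24 * r - 18)
    (by fun_prop) (by fun_prop)
    (fun r hr => by
      have h0 := hr.1
      have h1 := hr.2
      have h2 : r ^ 2 ≤ 1 := pow_le_one₀ h0 h1
      have h3 : r ^ 3 ≤ 1 := pow_le_one₀ h0 h1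
      have h4 := pow_nonneg h0 2
      have h5 := pow_nonneg h0 3
      rw [abs_le]; constructor <;> linarith)
    (fun r hr => by
      have h0 := hr.1
      have h1 := hr.2
      rw [abs_le]; constructor <;> linarith)
  simp only [value_eq_ray_integral hu, intervalIntegral.integral_const, sub_zero, one_smul]
    at this
  exact this

theorem sq_edge_trace_le {V : Fin 3 → E2} (hV : triangleCross V 0 ≠ 0)
    {u : E2 → ℝ} (hu : ContDiff ℝ 2 u) (k : Fin 3) :
    |triangleCross V 0| * (∫ s in (0 : ℝ)..1,
      (u (V (k + 1) + s • (V (k + 2) - V (k + 1)))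
        + fderiv ℝ u (V (k + 1) + s • (V (k + 2) - V (k + 1)))
          (V (k + 1) - V k + s • (V (k + 2) - V (k + 1))))) ^ 2
      ≤ 1800 * hessEnergy (convexHull ℝ (Set.range V))
        (Metric.diam (convexHull ℝ (Set.range V))) u := by
  rw [← triangleCross_eq_zero_index V k] at hV ⊢
  have := sq_weighted_integral_le (isCompact_triangle V) hV
    (fun s hs r hr => ray_mem_triangle V k hs hr) (fun s hs => norm_ray_le_diam V k hs) hu
    (a := fun r => 5 * r ^ 2 - 4 * r ^ 3) (b := fun r => 30 - 48 * r)
    (by fun_prop) (by fun_prop)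
    (fun r hr => by
      have h0 := hr.1
      have h1 := hr.2
      have h2 : r ^ 2 ≤ 1 := pow_le_one₀ h0 h1
      have h3 : r ^ 3 ≤ 1 := pow_le_one₀ h0 h1
      have h4 := pow_nonneg h0 2
      have h5 := pow_nonneg h0 3
      rw [abs_le]; constructor <;> linarith)
    (fun r hr => by
      have h0 := hr.1
      have h1 := hr.2
      rw [abs_le]; constructor <;> linarith)
  simp only [edge_trace_eq_ray_integral hu] at this
  have e : ∀ s : ℝ, V k + (V (k + 1) - V k + s • (V (k + 2) - V (k + 1)))
      = V (k + 1) + s • (V (k + 2) - V (k + 1)) := fun s => by abel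
  simp only [e] at this
  exact this

/-- Stability of the edge mean of a derivative in a direction `w`, where `α` measures the
tangential offset between `w` and the opposite vertex. -/
theorem sq_edge_deriv_le {V : Fin 3 → E2} (hV : triangleCross V 0 ≠ 0)
    {u : E2 → ℝ} (hu : ContDiff ℝ 2 u) (k : Fin 3) {w : E2} {α σ : ℝ}
    (hw : V (k + 1) - V k = -w - α • (V (k + 2) - V (k + 1))) (hα : |α| ≤ σ) :
    |triangleCross V 0| * (∫ s in (0 : ℝ)..1,
      fderiv ℝ u (V (k + 1) + s • (V (k + 2) - V (k + 1))) w) ^ 2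
      ≤ 1800 * (2 + 2 * σ) ^ 2 * hessEnergy (convexHull ℝ (Set.range V))
        (Metric.diam (convexHull ℝ (Set.range V))) u := by
  have hA := sq_vertex_value_le hV hu (k + 1)
  have hB := sq_vertex_value_le hV hu (k + 2)
  have hI := sq_edge_trace_le hV hu k
  set E := hessEnergy (convexHull ℝ (Set.range V))
        (Metric.diam (convexHull ℝ (Set.range V))) u
  set A := V (k + 1)
  set B := V (k + 2)
  set I := ∫ s in (0 : ℝ)..1, (u (A + s • (B - A))
        + fderiv ℝ u (A + s • (B - A)) (A - V k + s • (B - A))) with hIdef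
  set J := ∫ s in (0 : ℝ)..1, fderiv ℝ u (A + s • (B - A)) w with hJ
  have hcu : Continuous u := hu.continuous
  have hcd : Continuous (fderiv ℝ u) := hu.continuous_fderiv (by norm_num)
  have hsum : I + J = (1 - α) * u B + α * u A := by
    rw [hIdef, hJ, ← intervalIntegral.integral_add]
    · rw [intervalIntegral.integral_eq_sub_of_hasDerivAt
        (f := fun s => (s - α) * u (A + s • (B - A)))]
      · simp
      · intro s _
        refine (((hasDerivAt_id s).sub_const α).mul
          (hasDerivAt_along_ray hu A (B - A) s)).congr_deriv ?_
        rw [hw]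
        simp only [map_add, map_sub, map_neg, map_smul, smul_eq_mul, id]
        ring
      · exact Continuous.intervalIntegrable (by fun_prop) _ _
    · exact Continuous.intervalIntegrable (by fun_prop) _ _
    · exact Continuous.intervalIntegrable (by fun_prop) _ _
  have hD : 0 < |triangleCross V 0| := abs_pos.2 hV
  set D := |triangleCross V 0|
  set R := Real.sqrt (1800 * E / D)
  have hE : 0 ≤ E := hessEnergy_nonneg _ _ _
  have hR0 : 0 ≤ R := Real.sqrt_nonneg _
  have hR : R ^ 2 = 1800 * E / D := Real.sq_sqrt (by positivity)
  have key : ∀ x : ℝ, D * x ^ 2 ≤ 1800 * E → |x| ≤ R := fun x hx => by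
    refine Real.abs_le_sqrt ?_
    rw [le_div_iff₀ hD]; linarith
  have kA := key _ hA
  have kB := key _ hB
  have kI := key _ hI
  have hJle : |J| ≤ (2 + 2 * σ) * R := by
    have : J = (1 - α) * u B + α * u A - I := by linarith
    rw [this]
    have h1 : |(1 - α) * u B| ≤ (1 + σ) * R := by
      rw [abs_mul]
      refine mul_le_mul ?_ kB (abs_nonneg _) (by linarith [abs_nonneg α])
      refine (abs_sub _ _).trans ?_
      rw [abs_one]; linarith
    have h2 : |α * u A| ≤ σ * R := by
      rw [abs_mul]
      exact mul_le_mul hα kA (abs_nonneg _) (by linarith [abs_nonneg α])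
    calc _ ≤ |(1 - α) * u B| + |α * u A| + |I| :=
          (abs_sub _ _).trans (by gcongr; exact abs_add_le _ _)
      _ ≤ _ := by linarith
  have := pow_le_pow_left₀ (abs_nonneg _) hJle 2
  rw [sq_abs, mul_pow, hR] at this
  calc D * J ^ 2 ≤ D * ((2 + 2 * σ) ^ 2 * (1800 * E / D)) := by gcongr
    _ = _ := by field_simp

theorem edge_gradient_geometry {X Y a : E2} {h σ : ℝ} (hX : ‖X‖ ≤ h) (hY : ‖Y‖ ≤ h)
    (haX : ⟪a, X⟫ = -1) (haY : ⟪a, Y⟫ = 0) (hD : planeCross X Y ≠ 0)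
    (hσ : h ^ 2 ≤ σ * |planeCross X Y|) :
    (∀ n : E2, ⟪n, Y⟫ = 0 → n = ⟪a, n⟫ • (‖a‖ ^ 2)⁻¹ • a) ∧
    (∃ α : ℝ, |α| ≤ σ ∧ X = -((‖a‖ ^ 2)⁻¹ • a) - α • Y) ∧
    ‖a‖ ≤ h / |planeCross X Y| := by
  set D := planeCross X Y with hDdef
  have hD' : D = X 0 * Y 1 - X 1 * Y 0 := rfl
  have hDp : 0 < |D| := abs_pos.2 hD
  have nrm2 : ∀ v : E2, ‖v‖ ^ 2 = v 0 ^ 2 + v 1 ^ 2 := fun v => by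
    simp [EuclideanSpace.norm_sq_eq, Fin.sum_univ_two]
  have inn : ∀ v w : E2, ⟪v, w⟫ = v 0 * w 0 + v 1 * w 1 := fun v w => by
    simp [PiLp.inner_apply, Fin.sum_univ_two, mul_comm]
  rw [inn] at haX haY
  have a0 : a 0 * D = - Y 1 := by rw [hD']; linear_combination Y 1 * haX - X 1 * haY
  have a1 : a 1 * D = Y 0 := by rw [hD']; linear_combination X 0 * haY - Y 0 * haX
  have haD : ‖a‖ ^ 2 * D ^ 2 = ‖Y‖ ^ 2 := by
    rw [nrm2, nrm2]; linear_combination (a 0 * D - Y 1) * a0 + (a 1 * D + Y 0) * a1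
  have hane : a ≠ 0 := by
    rintro rfl
    simp at haX
  have ha2 : ‖a‖ ^ 2 ≠ 0 := by positivity
  have hY2 : ‖Y‖ ^ 2 ≠ 0 := by rw [← haD]; positivity
  have hYp : 0 < ‖Y‖ := by
    rcases (norm_nonneg Y).eq_or_lt with h0 | h0
    · rw [← h0] at hY2; simp at hY2
    · exact h0
  have hcs : |⟪X, Y⟫| ≤ ‖X‖ * ‖Y‖ := abs_real_inner_le_norm X Y
  have hlag : D ^ 2 + ⟪X, Y⟫ ^ 2 = ‖X‖ ^ 2 * ‖Y‖ ^ 2 := by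
    rw [inn, nrm2, nrm2, hD']; ring
  have hDle : |D| ≤ ‖X‖ * ‖Y‖ := by
    refine abs_le_of_sq_le_sq ?_ (by positivity)
    rw [mul_pow]
    nlinarith [sq_nonneg ⟪X, Y⟫]
  have hh : 0 < h := hYp.trans_le hY
  have hσ0 : 0 ≤ σ := by
    by_contra hneg
    push Not at hneg
    nlinarith [sq_nonneg h]
  have hhσ : h ≤ σ * ‖Y‖ := by
    have : h * h ≤ h * (σ * ‖Y‖) := by
      calc h * h = h ^ 2 := by ring
        _ ≤ σ * |D| := hσ
        _ ≤ σ * (h * ‖Y‖) := by gcongr; exact hDle.trans (by gcongr)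
        _ = _ := by ring
    exact le_of_mul_le_mul_left this hh
  refine ⟨fun n hn => ?_, ⟨-⟪X, Y⟫ / ‖Y‖ ^ 2, ?_, ?_⟩, ?_⟩
  · rw [inn] at hn
    have hp : a 0 * n 1 - a 1 * n 0 = 0 := by
      refine mul_right_cancel₀ hD ?_
      linear_combination n 1 * a0 - n 0 * a1 - hn
    ext i
    simp only [PiLp.smul_apply, smul_eq_mul]
    rw [inn]
    field_simp
    rw [nrm2]
    fin_cases i
    · simp; linear_combination (-a 1) * hp
    · simp; linear_combination (a 0) * hp
  · rw [abs_div, abs_neg, abs_of_pos (by positivity : 0 < ‖Y‖ ^ 2), div_le_iff₀ (by positivity)]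
    calc |⟪X, Y⟫| ≤ ‖X‖ * ‖Y‖ := hcs
      _ ≤ (σ * ‖Y‖) * ‖Y‖ := by gcongr; exact hX.trans hhσ
      _ = _ := by ring
  · have hinv : (‖a‖ ^ 2)⁻¹ = D ^ 2 / ‖Y‖ ^ 2 := by
      rw [← haD]; field_simp
    rw [hinv]
    ext i
    simp only [PiLp.smul_apply, PiLp.sub_apply, PiLp.neg_apply, smul_eq_mul]
    field_simp
    rw [nrm2, inn]
    fin_cases i
    · simp
      rw [hD'] at a0 ⊢
      linear_combination (X 0 * Y 1 - X 1 * Y 0) * a0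
    · simp
      rw [hD'] at a1 ⊢
      linear_combination (X 0 * Y 1 - X 1 * Y 0) * a1
  · rw [le_div_iff₀ hDp]
    refine le_trans (le_of_eq ?_) hY
    have := congrArg Real.sqrt haD
    rw [← sq_abs D, ← mul_pow, Real.sqrt_sq (by positivity), Real.sqrt_sq (norm_nonneg _)] at this
    exact this

/-- Derivative bounds of geometric type are multiplicative with additive rates. -/
theorem norm_iteratedFDeriv_mul_le_pow {f g : E2 → ℝ} (hf : ContDiff ℝ 2 f)
    (hg : ContDiff ℝ 2 g) {p : E2} {A B : ℝ}
    (hfA : ∀ n ≤ 2, ‖iteratedFDeriv ℝ n f p‖ ≤ A ^ n)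
    (hgB : ∀ n ≤ 2, ‖iteratedFDeriv ℝ n g p‖ ≤ B ^ n) :
    ∀ n ≤ 2, ‖iteratedFDeriv ℝ n (fun q => f q * g q) p‖ ≤ (A + B) ^ n := by
  intro n hn
  refine (norm_iteratedFDeriv_mul_le hf hg p (by exact_mod_cast hn)).trans ?_
  rw [add_pow]
  refine Finset.sum_le_sum fun i hi => ?_
  have hi' : i ≤ n := Nat.lt_succ_iff.1 (Finset.mem_range.1 hi)
  have h1 := hfA i (hi'.trans hn)
  have h2 := hgB (n - i) ((Nat.sub_le _ _).trans hn)
  calc _ = (n.choose i : ℝ) * (‖iteratedFDeriv ℝ i f p‖ * ‖iteratedFDeriv ℝ (n - i) g p‖) := by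
        ring
    _ ≤ (n.choose i : ℝ) * (A ^ i * B ^ (n - i)) := by
        refine mul_le_mul_of_nonneg_left ?_ (Nat.cast_nonneg _)
        exact mul_le_mul h1 h2 (norm_nonneg _) ((norm_nonneg _).trans h1)
    _ = _ := by ring

theorem hasFDerivAt_affine (a : E2) (b : ℝ) (p : E2) :
    HasFDerivAt (fun q : E2 => ⟪a, q⟫ + b) (innerSL ℝ a) p :=
  (innerSL ℝ a).hasFDerivAt.add_const b

theorem norm_iteratedFDeriv_affine_le (a : E2) (b : ℝ) {p : E2} {A : ℝ} (hA : ‖a‖ ≤ A)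
    (hp : |⟪a, p⟫ + b| ≤ 1) :
    ∀ n ≤ 2, ‖iteratedFDeriv ℝ n (fun q : E2 => ⟪a, q⟫ + b) p‖ ≤ A ^ n := by
  have hfd : fderiv ℝ (fun q : E2 => ⟪a, q⟫ + b) = fun _ => innerSL ℝ a :=
    funext fun q => (hasFDerivAt_affine a b q).fderiv
  intro n hn
  interval_cases n
  · simpa using hp
  · rw [norm_iteratedFDeriv_one, hfd]
    simpa using hA
  · rw [← norm_iteratedFDeriv_fderiv, hfd, iteratedFDeriv_const_of_ne one_ne_zero]
    simpa using sq_nonneg A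

/-- The quartic bubble with coefficients `c` built from barycentric coordinates `l`. -/
def quarticBubble (l : Fin 3 → E2 → ℝ) (c : Fin 3 → ℝ) (p : E2) : ℝ :=
  ∑ j : Fin 3, c j * (l j p * (l 0 p * l 1 p * l 2 p))

theorem contDiff_affine {l : E2 → ℝ} {a : E2} {b : ℝ} (hl : l = fun q => ⟪a, q⟫ + b) :
    ContDiff ℝ 2 l := by
  rw [hl]
  exact (contDiff_const.inner ℝ contDiff_id).add contDiff_const

theorem norm_iteratedFDeriv_quarticBubble_le {l : Fin 3 → E2 → ℝ} {a : Fin 3 → E2}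
    {b : Fin 3 → ℝ} (hl : ∀ j, l j = fun q => ⟪a j, q⟫ + b j) {A : ℝ} (hA : ∀ j, ‖a j‖ ≤ A)
    {p : E2} (hp : ∀ j, |l j p| ≤ 1) (c : Fin 3 → ℝ) :
    ∀ n ≤ 2, ‖iteratedFDeriv ℝ n (quarticBubble l c) p‖ ≤ (∑ j, |c j|) * (4 * A) ^ n := by
  have hcd : ∀ j, ContDiff ℝ 2 (l j) := fun j => contDiff_affine (hl j)
  have hb : ∀ j, ∀ n ≤ 2, ‖iteratedFDeriv ℝ n (l j) p‖ ≤ A ^ n := fun j => by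
    have h1 := hp j
    rw [hl j] at h1 ⊢
    exact norm_iteratedFDeriv_affine_le _ _ (hA j) h1
  intro n hn
  have hcd4 : ∀ j, ContDiff ℝ 2 fun q => l j q * (l 0 q * l 1 q * l 2 q) := fun j =>
    (hcd j).mul (((hcd 0).mul (hcd 1)).mul (hcd 2))
  have h4 : ∀ j, ‖iteratedFDeriv ℝ n (fun q => l j q * (l 0 q * l 1 q * l 2 q)) p‖
      ≤ (4 * A) ^ n := fun j => by
    have := norm_iteratedFDeriv_mul_le_pow (hcd j) (((hcd 0).mul (hcd 1)).mul (hcd 2)) (hb j)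
      (norm_iteratedFDeriv_mul_le_pow ((hcd 0).mul (hcd 1)) (hcd 2)
        (norm_iteratedFDeriv_mul_le_pow (hcd 0) (hcd 1) (hb 0) (hb 1)) (hb 2)) n hn
    refine this.trans (le_of_eq ?_)
    ring
  have hn' : (n : WithTop ℕ∞) ≤ 2 := by exact_mod_cast hn
  have hsum : iteratedFDeriv ℝ n (quarticBubble l c) p
      = ∑ j, c j • iteratedFDeriv ℝ n (fun q => l j q * (l 0 q * l 1 q * l 2 q)) p := by
    have e : quarticBubble l c
        = fun q => ∑ j, (c j • fun q => l j q * (l 0 q * l 1 q * l 2 q)) q := rfl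
    rw [e, iteratedFDeriv_fun_sum_apply]
    · refine Finset.sum_congr rfl fun j _ => ?_
      exact iteratedFDeriv_const_smul_apply ((hcd4 j).of_le hn').contDiffAt
    · exact fun j _ => (((hcd4 j).of_le hn').const_smul (c j)).contDiffAt
  rw [hsum, Finset.sum_mul]
  refine norm_sum_le_of_le _ fun j _ => ?_
  rw [norm_smul, Real.norm_eq_abs]
  exact mul_le_mul_of_nonneg_left (h4 j) (abs_nonneg _)

theorem barycentric_mem_Icc {V : Fin 3 → E2} {l : E2 → ℝ} {a : E2} {b : ℝ}
    (hl : l = fun q => ⟪a, q⟫ + b) (hv : ∀ k, l (V k) ∈ Set.Icc (0 : ℝ) 1) {p : E2}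
    (hp : p ∈ convexHull ℝ (Set.range V)) : l p ∈ Set.Icc (0 : ℝ) 1 := by
  have hconv : Convex ℝ (l ⁻¹' Set.Icc (0 : ℝ) 1) := by
    intro x hx y hy s t hs ht hst
    have e : l (s • x + t • y) = s • l x + t • l y := by
      simp only [hl, inner_add_right, real_inner_smul_right, smul_eq_mul]
      linear_combination (-b) * hst
    rw [Set.mem_preimage, e]
    exact convex_Icc 0 1 hx hy hs ht hst
  have hsub : Set.range V ⊆ l ⁻¹' Set.Icc (0 : ℝ) 1 := Set.range_subset_iff.2 hv
  exact convexHull_min hsub hconv hp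

theorem integral_edge_fderiv_quarticBubble {V : Fin 3 → E2} {l : Fin 3 → E2 → ℝ}
    {a : Fin 3 → E2} {b : Fin 3 → ℝ} (hl : ∀ j, l j = fun q => ⟪a j, q⟫ + b j)
    (hv : ∀ k j, l j (V k) = if k = j then (1 : ℝ) else 0) (c : Fin 3 → ℝ) (k : Fin 3) (n : E2) :
    ∫ t in (0 : ℝ)..1,
      fderiv ℝ (quarticBubble l c) (V (k + 1) + t • (V (k + 2) - V (k + 1))) n
      = ⟪a k, n⟫ * ((c (k + 1) + c (k + 2)) / 12) := by
  have hcd : ∀ j, Differentiable ℝ (l j) := fun j =>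
    (contDiff_affine (hl j)).differentiable (by norm_num)
  have hbary : ∀ (j : Fin 3) (t : ℝ), l j (V (k + 1) + t • (V (k + 2) - V (k + 1)))
      = (1 - t) * (if k + 1 = j then (1 : ℝ) else 0) + t * (if k + 2 = j then (1 : ℝ) else 0) := by
    intro j t
    rw [← hv, ← hv]
    simp only [hl, inner_add_right, inner_sub_right, real_inner_smul_right]
    ring
  have hval : ∀ t : ℝ, fderiv ℝ (quarticBubble l c) (V (k + 1) + t • (V (k + 2) - V (k + 1))) n
      = ⟪a k, n⟫ * ((c (k + 1) * (1 - t) + c (k + 2) * t) * ((1 - t) * t)) := by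
    intro t
    set p := V (k + 1) + t • (V (k + 2) - V (k + 1))
    have hq : quarticBubble l c
        = fun q => l k q * ((∑ j, c j * l j q) * (l (k + 1) q * l (k + 2) q)) := by
      ext q
      rw [quarticBubble, Fin.sum_univ_three, Fin.sum_univ_three]
      fin_cases k <;> simp <;> ring
    have hg : DifferentiableAt ℝ
        (fun q => (∑ j, c j * l j q) * (l (k + 1) q * l (k + 2) q)) p := by
      have := fun j => hcd j p
      fun_prop
    have hk : HasFDerivAt (l k) (innerSL ℝ (a k)) p := by
      rw [hl k]; exact hasFDerivAt_affine _ _ _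
    have hk0 : l k p = 0 := by
      rw [hbary]; fin_cases k <;> simp
    have hk1 : l (k + 1) p = 1 - t := by
      rw [hbary]; fin_cases k <;> simp
    have hk2 : l (k + 2) p = t := by
      rw [hbary]; fin_cases k <;> simp
    have hs : ∑ j, c j * l j p = c (k + 1) * (1 - t) + c (k + 2) * t := by
      have hcyc : ∀ f : Fin 3 → ℝ, ∑ j, f j = f k + f (k + 1) + f (k + 2) := fun f => by
        rw [Fin.sum_univ_three]
        fin_cases k <;> simp <;> ring
      rw [hcyc, hk0, hk1, hk2, mul_zero, zero_add]
    rw [hq, (hk.fun_mul hg.hasFDerivAt).fderiv]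
    simp only [hk0, hs, hk1, hk2, zero_smul, zero_add, _root_.smul_apply,
      innerSL_apply_apply, smul_eq_mul]
    ring
  simp only [hval]
  rw [intervalIntegral.integral_const_mul]
  congr 1
  rw [intervalIntegral.integral_eq_sub_of_hasDerivAt
    (f := fun t => c (k + 1) * (t ^ 2 / 2 - 2 * t ^ 3 / 3 + t ^ 4 / 4)
      + c (k + 2) * (t ^ 3 / 3 - t ^ 4 / 4))]
  · ring
  · intro t _
    have h2 := (hasDerivAt_pow 2 t).div_const 2
    have h3 := ((hasDerivAt_pow 3 t).const_mul 2).div_const 3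
    have h3' := (hasDerivAt_pow 3 t).div_const 3
    have h4 := (hasDerivAt_pow 4 t).div_const 4
    refine ((((h2.sub h3).add h4).const_mul (c (k + 1))).add
      ((h3'.sub h4).const_mul (c (k + 2)))).congr_deriv ?_
    norm_num
    ring
  · exact Continuous.intervalIntegrable (by fun_prop) _ _

theorem exists_local_bubble {σ : ℝ} {V : Fin 3 → E2} {l : Fin 3 → E2 → ℝ} {nrm : Fin 3 → E2}
    {u : E2 → ℝ} (hl : ∀ j, ∃ (a : E2) (b : ℝ), l j = fun p => ⟪a, p⟫ + b)
    (hv : ∀ k j, l j (V k) = if k = j then (1 : ℝ) else 0)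
    (hn : ∀ k, ⟪nrm k, V (k + 2) - V (k + 1)⟫ = 0)
    (hσ : Metric.diam (convexHull ℝ (Set.range V)) ^ 2
      ≤ σ * (volume (convexHull ℝ (Set.range V))).toReal)
    (hσ0 : 0 ≤ σ) (hu : ContDiff ℝ 2 u) :
    ∃ c : Fin 3 → ℝ,
      (∀ k, ∫ t in (0 : ℝ)..1,
          fderiv ℝ (quarticBubble l c) (V (k + 1) + t • (V (k + 2) - V (k + 1))) (nrm k)
        = ∫ t in (0 : ℝ)..1, fderiv ℝ u (V (k + 1) + t • (V (k + 2) - V (k + 1))) (nrm k)) ∧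
      hessEnergy (convexHull ℝ (Set.range V)) (Metric.diam (convexHull ℝ (Set.range V)))
          (quarticBubble l c)
        ≤ 8100 * (1800 * (2 + 2 * σ) ^ 2) * (1 + 256 * σ ^ 4)
          * hessEnergy (convexHull ℝ (Set.range V))
            (Metric.diam (convexHull ℝ (Set.range V))) u := by
  choose a b hl using hl
  set T := convexHull ℝ (Set.range V)
  set h := Metric.diam T
  have hdiff : ∀ j k k', ⟪a j, V k - V k'⟫
      = (if k = j then (1 : ℝ) else 0) - if k' = j then (1 : ℝ) else 0 := by
    intro j k k'
    rw [← hv, ← hv, hl j]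
    simp only [inner_sub_right]
    ring
  have hD : triangleCross V 0 ≠ 0 := by
    have e : planeCross (a 0) (a 1) * triangleCross V 0 = 1 := by
      have h1 := hdiff 0 1 0
      have h2 := hdiff 0 2 1
      have h3 := hdiff 1 1 0
      have h4 := hdiff 1 2 1
      have e1 : planeCross (a 0) (a 1) * triangleCross V 0
          = ⟪a 0, V 1 - V 0⟫ * ⟪a 1, V 2 - V 1⟫ - ⟪a 0, V 2 - V 1⟫ * ⟪a 1, V 1 - V 0⟫ := by
        simp [PiLp.inner_apply, Fin.sum_univ_two, planeCross, triangleCross]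
        ring
      rw [e1, h1, h2, h3, h4]
      simp
    intro h0
    rw [h0, mul_zero] at e
    exact zero_ne_one e
  set D := |triangleCross V 0| with hDdef
  have hDp : 0 < D := abs_pos.2 hD
  have hvol : (volume T).toReal ≤ D := by
    have := volume_triangle_le (V 0) (V 1 - V 0) (V 2 - V 1)
    have hr : ({V 0, V 0 + (V 1 - V 0), V 0 + (V 1 - V 0) + (V 2 - V 1)} : Set E2)
        = Set.range V := by
      ext p
      simp [Fin.exists_fin_succ, eq_comm]
    rw [hr] at this
    exact this
  have hσD : h ^ 2 ≤ σ * D := hσ.trans (mul_le_mul_of_nonneg_left hvol hσ0)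
  have hgeo := fun k => edge_gradient_geometry (X := V (k + 1) - V k)
    (Y := V (k + 2) - V (k + 1)) (a := a k) (h := h) (σ := σ)
    (by
      have := norm_ray_le_diam V k (Set.left_mem_Icc.2 (zero_le_one' ℝ))
      rw [zero_smul, add_zero] at this
      exact this)
    (by
      have := norm_ray_le_diam V (k + 1) (Set.left_mem_Icc.2 (zero_le_one' ℝ))
      rw [zero_smul, add_zero, add_assoc] at this
      exact this)
    (by rw [hdiff]; fin_cases k <;> simp)
    (by rw [hdiff]; fin_cases k <;> simp)
    (by
      have := triangleCross_eq_zero_index V k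
      unfold triangleCross at this hD
      rwa [this])
    (by
      have := triangleCross_eq_zero_index V k
      rw [hDdef, ← this] at hσD
      exact hσD)
  have ha : ∀ k, ‖a k‖ ≤ h / D := fun k => by
    have := (hgeo k).2.2
    rwa [hDdef, ← triangleCross_eq_zero_index V k]
  set w : Fin 3 → E2 := fun k => (‖a k‖ ^ 2)⁻¹ • a k
  set J : Fin 3 → ℝ := fun k =>
    ∫ s in (0 : ℝ)..1, fderiv ℝ u (V (k + 1) + s • (V (k + 2) - V (k + 1))) (w k) with hJ
  set E := hessEnergy T h u
  have hE : 0 ≤ E := hessEnergy_nonneg _ _ _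
  set Q := 1800 * (2 + 2 * σ) ^ 2 * E with hQ
  have hQ0 : 0 ≤ Q := by positivity
  have hJQ : ∀ k, D * J k ^ 2 ≤ Q := fun k => by
    obtain ⟨α, hα, hX⟩ := (hgeo k).2.1
    exact sq_edge_deriv_le hD hu k hX hα
  set R := Real.sqrt (Q / D)
  have hR : R ^ 2 = Q / D := Real.sq_sqrt (by positivity)
  have hJR : ∀ k, |J k| ≤ R := fun k => by
    refine Real.abs_le_sqrt ?_
    rw [le_div_iff₀ hDp, mul_comm]
    exact hJQ k
  set c : Fin 3 → ℝ := fun j => 6 * (J 0 + J 1 + J 2) - 12 * J j with hc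
  have hcR : ∀ j, |c j| ≤ 30 * R := fun j => by
    have h0 := abs_le.1 (hJR 0)
    have h1 := abs_le.1 (hJR 1)
    have h2 := abs_le.1 (hJR 2)
    have h3 := abs_le.1 (hJR j)
    rw [abs_le]
    constructor <;> simp only [hc] <;> linarith
  set S := ∑ j, |c j| with hS
  have hS0 : 0 ≤ S := Finset.sum_nonneg fun _ _ => abs_nonneg _
  have hSR : S ≤ 90 * R := by
    rw [hS, Fin.sum_univ_three]
    linarith [hcR 0, hcR 1, hcR 2]
  have hSD : S ^ 2 * D ≤ 8100 * Q := by
    calc S ^ 2 * D ≤ (90 * R) ^ 2 * D := by gcongr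
      _ = 8100 * Q := by rw [mul_pow, hR]; field_simp; ring
  refine ⟨c, fun k => ?_, ?_⟩
  · rw [integral_edge_fderiv_quarticBubble hl hv]
    have hnk := (hgeo k).1 (nrm k) (hn k)
    have hck : (c (k + 1) + c (k + 2)) / 12 = J k := by
      simp only [hc]
      fin_cases k <;> simp <;> ring
    rw [hck, hJ, ← intervalIntegral.integral_const_mul]
    congr 1
    ext t
    conv_rhs => rw [hnk, map_smul, smul_eq_mul]
  · have hbound : ∀ p ∈ T, ∀ n ≤ 2,
        ‖iteratedFDeriv ℝ n (quarticBubble l c) p‖ ≤ S * (4 * (h / D)) ^ n := by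
      intro p hp
      refine norm_iteratedFDeriv_quarticBubble_le hl ha (fun j => ?_) c
      have := barycentric_mem_Icc (hl j) (fun k => by rw [hv]; split_ifs <;> simp) hp
      rw [abs_of_nonneg this.1]
      exact this.2
    have hTfin : volume T < ⊤ := (isCompact_triangle V).measure_lt_top
    have hI : ∀ (n : ℕ), n ≤ 2 →
        ∫ p in T, ‖iteratedFDeriv ℝ n (quarticBubble l c) p‖ ^ 2
          ≤ (S * (4 * (h / D)) ^ n) ^ 2 * D := by
      intro n hn2
      refine (Real.le_norm_self _).trans ?_
      refine (norm_setIntegral_le_of_norm_le_const hTfin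
        (C := (S * (4 * (h / D)) ^ n) ^ 2) fun p hp => ?_).trans ?_
      · rw [norm_pow, norm_norm]
        gcongr
        exact hbound p hp n hn2
      · exact mul_le_mul_of_nonneg_left hvol (sq_nonneg _)
    have hI0 := hI 0 (by norm_num)
    have hI2 := hI 2 le_rfl
    simp only [norm_iteratedFDeriv_zero, Real.norm_eq_abs, sq_abs, pow_zero, mul_one] at hI0
    have hρ : (h ^ 2 / D) ^ 4 ≤ σ ^ 4 := by
      refine pow_le_pow_left₀ (by positivity) ?_ 4
      rwa [div_le_iff₀ hDp]
    unfold hessEnergy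
    calc _ ≤ S ^ 2 * D + h ^ 4 * ((S * (4 * (h / D)) ^ 2) ^ 2 * D) := by gcongr
      _ = (S ^ 2 * D) * (1 + 256 * (h ^ 2 / D) ^ 4) := by field_simp; ring
      _ ≤ (8100 * Q) * (1 + 256 * σ ^ 4) := by gcongr
      _ = _ := by rw [hQ]; ring

/-- Local energy bounds sum to a bound between the global weighted norms. -/
theorem sqrt_sum_add_sqrt_sum_le {ι : Type*} (s : Finset ι) {K : ℝ} (hK : 0 ≤ K)
    {A B a b : ι → ℝ} (hA : ∀ i ∈ s, 0 ≤ A i) (hB : ∀ i ∈ s, 0 ≤ B i)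
    (h : ∀ i ∈ s, A i + B i ≤ K * (a i + b i))
    (ha : ∀ i ∈ s, 0 ≤ a i) (hb : ∀ i ∈ s, 0 ≤ b i) :
    (∑ i ∈ s, A i).sqrt + (∑ i ∈ s, B i).sqrt
      ≤ 2 * K.sqrt * ((∑ i ∈ s, a i).sqrt + (∑ i ∈ s, b i).sqrt) := by
  have key : (K * (∑ i ∈ s, a i + ∑ i ∈ s, b i)).sqrt
      ≤ K.sqrt * ((∑ i ∈ s, a i).sqrt + (∑ i ∈ s, b i).sqrt) := by
    rw [Real.sqrt_mul hK]
    gcongr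
    have ha' := Finset.sum_nonneg ha
    have hb' := Finset.sum_nonneg hb
    refine Real.sqrt_le_iff.2 ⟨by positivity, ?_⟩
    nlinarith [Real.sq_sqrt ha', Real.sq_sqrt hb',
      mul_nonneg (Real.sqrt_nonneg (∑ i ∈ s, a i)) (Real.sqrt_nonneg (∑ i ∈ s, b i))]
  have h1 : (∑ i ∈ s, A i).sqrt ≤ (K * (∑ i ∈ s, a i + ∑ i ∈ s, b i)).sqrt := by
    refine Real.sqrt_le_sqrt ?_
    rw [← Finset.sum_add_distrib, Finset.mul_sum]
    exact Finset.sum_le_sum fun i hi => by linarith [h i hi, hB i hi]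
  have h2 : (∑ i ∈ s, B i).sqrt ≤ (K * (∑ i ∈ s, a i + ∑ i ∈ s, b i)).sqrt := by
    refine Real.sqrt_le_sqrt ?_
    rw [← Finset.sum_add_distrib, Finset.mul_sum]
    exact Finset.sum_le_sum fun i hi => by linarith [h i hi, hA i hi]
  linarith

/- STATEMENT 11 (Lemma 3.12: the elementwise quartic-bubble operator `F⁰`).
`𝒯` is a shape-regular triangulation (elements indexed by `s : Finset ℕ`,
element `i` the triangle with vertices `V i 0, V i 1, V i 2`, barycentric
coordinates `lam i j`, outer edge normals `nrm i k`) of the polygon `Ω ⊆ ℝ²`;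
shape regularity is quantified by `diam(T)² ≤ σ·|T|`.
`u ∈ H²_{0,mesh}(𝒯) = H²(𝒯) ∩ H¹₀(Ω)` is encoded by elementwise smooth
representatives `uT i` (with `u = uT i` on element `i`, `u` continuous and
vanishing on `∂Ω`).  The operator value `F⁰u` is the piecewise quartic element
bubble `p ↦ Σ_j c i j · λ_j λ₀λ₁λ₂` on element `i` (hence in `P⁴_b(𝒯) ⊆ H¹₀(Ω)`,
as bubbles vanish on all element boundaries).
Conclusions: (i) `⟨δη, F⁰u⟩_𝒮 = ⟨δη, u⟩_𝒮` for every edgewise constant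
`δη ∈ P⁰(𝒮)` (edgewise mean values of the normal-derivative jumps agree);
(ii) `‖F⁰u‖ + ‖h_𝒯² D²F⁰u‖_𝒯 ≤ C (‖u‖ + ‖h_𝒯² D²u‖_𝒯)` with `C` depending only
on the shape-regularity constant `σ`. -/
theorem bubble_operator_F0
    (σ : ℝ) (hσ : 0 < σ) :
    ∃ C > 0,
      ∀ (s : Finset ℕ) (V : ℕ → Fin 3 → E2)
        (lam : ℕ → Fin 3 → E2 → ℝ) (nrm : ℕ → Fin 3 → E2)
        (Ω : Set E2) (u : E2 → ℝ) (uT : ℕ → E2 → ℝ),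
        -- mesh data
        (∀ i ∈ s, AffineIndependent ℝ (V i)) →
        (∀ i ∈ s, ∀ j, ∃ (a : E2) (b : ℝ), lam i j = fun p => ⟪a, p⟫ + b) →
        (∀ i ∈ s, ∀ k j, lam i j (V i k) = if k = j then (1:ℝ) else 0) →
        (∀ i ∈ s, ∀ k, ‖nrm i k‖ = 1 ∧ ⟪nrm i k, V i (k+2) - V i (k+1)⟫ = 0) →
        IsOpen Ω →
        (⋃ i ∈ s, elt V i) = closure Ω →
        (Set.Pairwise ↑s fun i i' => Disjoint (interior (elt V i)) (interior (elt V i'))) →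
        -- shape regularity with constant σ
        (∀ i ∈ s, (Metric.diam (elt V i)) ^ 2 ≤ σ * (volume (elt V i)).toReal) →
        -- u ∈ H²(𝒯) ∩ H¹₀(Ω), with elementwise smooth representatives uT i
        (∀ i ∈ s, ContDiff ℝ 2 (uT i)) →
        (∀ i ∈ s, Set.EqOn u (uT i) (elt V i)) →
        ContinuousOn u (closure Ω) →
        (∀ p ∈ frontier Ω, u p = 0) →
        -- the bubble coefficients of F⁰u
        ∃ c : ℕ → Fin 3 → ℝ,
          -- (i) preservation of the edgewise means of normal-derivative jumps
          (∀ η : E2 → E2 → ℝ, (∀ a b, η a b = η b a) →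
            skelPair s V nrm η
                (fun i p => ∑ j : Fin 3,
                  c i j * (lam i j p * (lam i 0 p * lam i 1 p * lam i 2 p)))
              = skelPair s V nrm η uT) ∧
          -- (ii) weighted L²/H² stability, with constant depending only on σ
          ((∑ i ∈ s, ∫ p in elt V i,
              (∑ j : Fin 3,
                c i j * (lam i j p * (lam i 0 p * lam i 1 p * lam i 2 p))) ^ 2).sqrt
            + (∑ i ∈ s, (Metric.diam (elt V i)) ^ 4 *
                ∫ p in elt V i,
                  ‖iteratedFDeriv ℝ 2
                    (fun q => ∑ j : Fin 3,
                      c i j * (lam i j q * (lam i 0 q * lam i 1 q * lam i 2 q))) p‖ ^ 2).sqrt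
            ≤ C * ((∑ i ∈ s, ∫ p in elt V i, (uT i p) ^ 2).sqrt
                + (∑ i ∈ s, (Metric.diam (elt V i)) ^ 4 *
                    ∫ p in elt V i, ‖iteratedFDeriv ℝ 2 (uT i) p‖ ^ 2).sqrt)) := by
  refine ⟨2 * (8100 * (1800 * (2 + 2 * σ) ^ 2) * (1 + 256 * σ ^ 4)).sqrt, by positivity, ?_⟩
  intro s V lam nrm Ω u uT _ hlam hv hnrm _ _ _ hshape hu _ _ _
  have hloc : ∀ i, ∃ c : Fin 3 → ℝ, i ∈ s →
      (∀ k, ∫ t in (0 : ℝ)..1, fderiv ℝ (quarticBubble (lam i) c)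
          (V i (k + 1) + t • (V i (k + 2) - V i (k + 1))) (nrm i k)
        = ∫ t in (0 : ℝ)..1,
          fderiv ℝ (uT i) (V i (k + 1) + t • (V i (k + 2) - V i (k + 1))) (nrm i k)) ∧
      hessEnergy (elt V i) (Metric.diam (elt V i)) (quarticBubble (lam i) c)
        ≤ 8100 * (1800 * (2 + 2 * σ) ^ 2) * (1 + 256 * σ ^ 4)
          * hessEnergy (elt V i) (Metric.diam (elt V i)) (uT i) := by
    intro i
    by_cases hi : i ∈ s
    · obtain ⟨c, hc⟩ := exists_local_bubble (hlam i hi) (hv i hi) (fun k => (hnrm i hi k).2)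
        (hshape i hi) hσ.le (hu i hi)
      exact ⟨c, fun _ => hc⟩
    · exact ⟨0, fun h => absurd h hi⟩
  choose c hc using hloc
  refine ⟨c, fun η _ => ?_, ?_⟩
  · refine Finset.sum_congr rfl fun i hi => Finset.sum_congr rfl fun k _ => ?_
    congr 1
    exact (hc i hi).1 k
  · have hnn : ∀ (f : E2 → ℝ) (i : ℕ), 0 ≤ ∫ p in elt V i, f p ^ 2 := fun f i =>
      integral_nonneg fun _ => sq_nonneg _
    have hnn2 : ∀ (f : E2 → ℝ) (i : ℕ),
        0 ≤ Metric.diam (elt V i) ^ 4 * ∫ p in elt V i, ‖iteratedFDeriv ℝ 2 f p‖ ^ 2 :=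
      fun f i => mul_nonneg (by positivity) (integral_nonneg fun _ => sq_nonneg _)
    exact sqrt_sum_add_sqrt_sum_le s (by positivity)
      (A := fun i => ∫ p in elt V i, quarticBubble (lam i) (c i) p ^ 2)
      (B := fun i => Metric.diam (elt V i) ^ 4 *
        ∫ p in elt V i, ‖iteratedFDeriv ℝ 2 (quarticBubble (lam i) (c i)) p‖ ^ 2)
      (fun i _ => hnn _ i) (fun i _ => hnn2 _ i) (fun i hi => (hc i hi).2)
      (fun i _ => hnn (uT i) i) (fun i _ => hnn2 (uT i) i)

end
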